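/- arXiv:1202.6188 — 2 statements merged into one kernel-verified Lean document; each statement's English description precedes it below -/
import Mathlib

section
/- One has Q̂(R = T+1) = Q̂(X_T < ∞) = E^Q[X_T]/x_0. Consequently, Q̂(R = T+1) = 1 if and only if X is a true Q-martingale. Moreover, if X is a Q-martingale, then Q̂ is absolutely continuous with respect to Q on F_T with density dQ̂/dQ = X_T/x_0, i.e., Q̂(A) = (1/x_0)·E^Q[1_A · X_T] for all A ∈ F_T; and if X is a strict Q-local martingale (a Q-local martingale that is not a Q-martingale), then Q̂(X_T < ∞) < 1 and Q̂ is not absolutely continuous with respect to Q on F_T. -/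
open MeasureTheory Filter Set Topology
open scoped ENNReal NNReal

noncomputable section

namespace Paper

/-- `τ` is a stopping time with respect to the raw filtration `F`,
taking values in `[0,T] ∪ {T+1}`. -/
def IsStopT {Ω : Type*} (F : ℝ → MeasurableSpace Ω) (T : ℝ) (τ : Ω → ℝ) : Prop :=
  (∀ t : ℝ, MeasurableSet[F t] {ω | τ ω ≤ t}) ∧ ∀ ω, τ ω ∈ Icc (0:ℝ) T ∪ {T + 1}

/-- `A ∈ F_τ`, the σ-algebra associated with the stopping time `τ`. -/
def MemFtau {Ω : Type*} (F : ℝ → MeasurableSpace Ω) (τ : Ω → ℝ) (A : Set Ω) : Prop :=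
  ∀ t : ℝ, MeasurableSet[F t] (A ∩ {ω | τ ω ≤ t})

/-- the σ-algebra `F_τ` of a stopping time `τ` (for a stopping time the generating
family below is already a σ-algebra, so this is exactly the usual `F_τ`). -/
def sigmaAt {Ω : Type*} (F : ℝ → MeasurableSpace Ω) (τ : Ω → ℝ) : MeasurableSpace Ω :=
  MeasurableSpace.generateFrom {A | MemFtau F τ A}

/-- the stopped process `N^τ`, i.e. `N^τ_t := N_{t ∧ τ ∧ T}`. -/
def stopped {Ω : Type*} (T : ℝ) (N : ℝ → Ω → ℝ≥0∞) (τ : Ω → ℝ) : ℝ → Ω → ℝ≥0∞ :=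
  fun t ω => N (min t (min (τ ω) T)) ω

/-- the value of a process at a stopping time, `N_τ := N_{τ ∧ T}`. -/
def valueAt {Ω : Type*} (T : ℝ) (N : ℝ → Ω → ℝ≥0∞) (τ : Ω → ℝ) : Ω → ℝ≥0∞ :=
  fun ω => N (min (τ ω) T) ω

/-- `N` is a `P`-martingale on the time horizon `[0,T]`: it is adapted, `P`-integrable, and
satisfies `E^P[N_t ∣ F_s] = N_s` for all `0 ≤ s ≤ t ≤ T`.  For nonnegative
(`ℝ≥0∞`-valued) integrable adapted processes the conditional-expectation identity is
equivalent to the defining set-integral identity used here. -/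
def IsMart {Ω : Type*} (F : ℝ → MeasurableSpace Ω) (T : ℝ) (P : @Measure Ω (F T))
    (N : ℝ → Ω → ℝ≥0∞) : Prop :=
  (∀ t ∈ Icc (0:ℝ) T, Measurable[F t] (N t)) ∧
  (∀ t ∈ Icc (0:ℝ) T, ∫⁻ ω, N t ω ∂P ≠ ⊤) ∧
  ∀ s t : ℝ, 0 ≤ s → s ≤ t → t ≤ T → ∀ A : Set Ω, MeasurableSet[F s] A →
    ∫⁻ ω in A, N t ω ∂P = ∫⁻ ω in A, N s ω ∂P

/-- `N` is a `P`-local martingale on `[0,T]`. -/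
def IsLocMart {Ω : Type*} (F : ℝ → MeasurableSpace Ω) (T : ℝ) (P : @Measure Ω (F T))
    (N : ℝ → Ω → ℝ≥0∞) : Prop :=
  ∃ τ : ℕ → Ω → ℝ, (∀ n, IsStopT F T (τ n)) ∧ (∀ n ω, τ n ω ≤ τ (n + 1) ω) ∧
    P {ω | ∀ᶠ n in atTop, τ n ω = T + 1} = 1 ∧
    ∀ n, IsMart F T P (stopped T N (τ n))

/-- `N` is a `P`-local martingale on the stochastic interval `[0,τ)`. -/
def IsLocMartBefore {Ω : Type*} (F : ℝ → MeasurableSpace Ω) (T : ℝ) (P : @Measure Ω (F T))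
    (N : ℝ → Ω → ℝ≥0∞) (τ : Ω → ℝ) : Prop :=
  ∀ σ : Ω → ℝ, IsStopT F T σ → (∀ᵐ ω ∂P, σ ω < τ ω) → IsLocMart F T P (stopped T N σ)

/-- `N` is a `P`-martingale on the stochastic interval `[0,τ)`. -/
def IsMartBefore {Ω : Type*} (F : ℝ → MeasurableSpace Ω) (T : ℝ) (P : @Measure Ω (F T))
    (N : ℝ → Ω → ℝ≥0∞) (τ : Ω → ℝ) : Prop :=
  ∀ σ : Ω → ℝ, IsStopT F T σ → (∀ᵐ ω ∂P, σ ω < τ ω) → IsMart F T P (stopped T N σ)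

/-- the first time in `[0,T]` at which `X` is `≥ c`; equal to `T+1` if this never
happens (`inf ∅ := T+1`). -/
def hitAbove {Ω : Type*} (T : ℝ) (X : ℝ → Ω → ℝ≥0∞) (c : ℝ≥0∞) (ω : Ω) : ℝ :=
  sInf ({t ∈ Icc (0:ℝ) T | c ≤ X t ω} ∪ {T + 1})

/-- the first time in `[0,T]` at which `X` is `≤ c`; equal to `T+1` if this never
happens (`inf ∅ := T+1`). -/
def hitBelow {Ω : Type*} (T : ℝ) (X : ℝ → Ω → ℝ≥0∞) (c : ℝ≥0∞) (ω : Ω) : ℝ :=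
  sInf ({t ∈ Icc (0:ℝ) T | X t ω ≤ c} ∪ {T + 1})

/-- `R = lim_i R_i` where `R_i = inf {t ∈ [0,T] : X_t ≥ i}` (explosion time of `X`);
the nondecreasing limit is the supremum. -/
def Rt {Ω : Type*} (T : ℝ) (X : ℝ → Ω → ℝ≥0∞) (ω : Ω) : ℝ :=
  ⨆ i : ℕ, hitAbove T X (i : ℝ≥0∞) ω

/-- `S = lim_i S_i` where `S_i = inf {t ∈ [0,T] : X_t ≤ 1/i}` (hitting time of `0`);
the nondecreasing limit is the supremum. -/
def St {Ω : Type*} (T : ℝ) (X : ℝ → Ω → ℝ≥0∞) (ω : Ω) : ℝ :=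
  ⨆ i : ℕ, hitBelow T X ((i : ℝ≥0∞))⁻¹ ω

/-- The standing assumptions: `0 < T`; `(F_t)` is a (monotone) filtration that is
right-continuous on `[0,T)`; `X` is adapted with continuous `[0,∞]`-valued paths absorbed
at `0` and `∞`; `x₀ ∈ (0,∞)`; `Q` is a probability measure on `F_T` with
`Q(R = T+1) = 1`, `Q(X_0 = x₀) = 1` and `X` a `Q`-local martingale. -/
structure Setup {Ω : Type*} (F : ℝ → MeasurableSpace Ω) (T : ℝ) (X : ℝ → Ω → ℝ≥0∞)
    (x₀ : ℝ≥0∞) (Q : @Measure Ω (F T)) : Prop where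
  T_pos : 0 < T
  mono : ∀ s t : ℝ, s ≤ t → F s ≤ F t
  rightCont : ∀ t ∈ Ico (0:ℝ) T, F t = ⨅ s ∈ Ioc t T, F s
  prob : IsProbabilityMeasure Q
  adapted : ∀ t ∈ Icc (0:ℝ) T, Measurable[F t] (X t)
  contPaths : ∀ ω, ContinuousOn (fun t => X t ω) (Icc 0 T)
  absorbing : ∀ ω, ∀ t ∈ Icc (0:ℝ) T, (X t ω = 0 ∨ X t ω = ⊤) →
    ∀ s ∈ Icc t T, X s ω = X t ω
  x₀_pos : 0 < x₀
  x₀_lt_top : x₀ < ⊤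
  noExplosion : Q {ω | Rt T X ω = T + 1} = 1
  init : Q {ω | X 0 ω = x₀} = 1
  locMart : IsLocMart F T Q X

/-- The numéraire relation between `Q` and `Q̂`: for every stopping time `τ` with values
in `[0,T] ∪ {T+1}` and every `A ∈ F_τ`,
`Q̂(A ∩ {X_τ < ∞}) = (1/x₀)·E^Q[1_A · X_τ]` (with `X_τ := X_{τ ∧ T}`). -/
def NumeraireRel {Ω : Type*} (F : ℝ → MeasurableSpace Ω) (T : ℝ) (X : ℝ → Ω → ℝ≥0∞)
    (x₀ : ℝ≥0∞) (Q Qh : @Measure Ω (F T)) : Prop :=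
  ∀ τ : Ω → ℝ, IsStopT F T τ → ∀ A : Set Ω, MemFtau F τ A →
    Qh (A ∩ {ω | valueAt T X τ ω < ⊤}) = (∫⁻ ω in A, valueAt T X τ ω ∂Q) / x₀

section

variable {Ω : Type*} {F : ℝ → MeasurableSpace Ω} {T : ℝ} {X : ℝ → Ω → ℝ≥0∞} {x₀ : ℝ≥0∞}

/-- Almost sure events may be intersected away. -/
lemma measure_inter_of_prob_eq_one {m : MeasurableSpace Ω} {P : Measure Ω}
    [IsProbabilityMeasure P] {B : Set Ω} (hB : MeasurableSet B) (h : P B = 1) (A : Set Ω) :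
    P (A ∩ B) = P A :=
  measure_inter_conull ((prob_compl_eq_zero_iff hB).2 h)

/-- A constant time in `[0,T]` is a stopping time. -/
lemma isStopT_const {t : ℝ} (ht : t ∈ Icc (0 : ℝ) T) : IsStopT F T fun _ => t :=
  ⟨fun r => @MeasurableSet.const _ (F r) (t ≤ r), fun _ => Or.inl ht⟩

/-- Events known at time `t` belong to the σ-algebra of the constant time `t`. -/
lemma memFtau_const (hmono : ∀ s t : ℝ, s ≤ t → F s ≤ F t) {t : ℝ} {A : Set Ω}
    (hA : MeasurableSet[F t] A) : MemFtau F (fun _ => t) A := by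
  intro r
  by_cases h : t ≤ r
  · simpa [h] using hmono t r h A hA
  · simp [h]

/-- A path absorbed at `∞` explodes before time `T` exactly if its terminal value is `∞`. -/
lemma Rt_eq_iff (hT : 0 ≤ T) {ω : Ω} (hcont : ContinuousOn (fun t => X t ω) (Icc 0 T))
    (habs : ∀ t ∈ Icc (0 : ℝ) T, X t ω = ⊤ → X T ω = ⊤) :
    Rt T X ω = T + 1 ↔ X T ω < ⊤ := by
  have hTmem : T ∈ Icc (0 : ℝ) T := ⟨hT, le_rfl⟩
  have hbdd : ∀ c, BddBelow ({t ∈ Icc (0 : ℝ) T | c ≤ X t ω} ∪ {T + 1}) := by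
    refine fun c => ⟨0, ?_⟩
    rintro t (ht | rfl)
    · exact ht.1.1
    · positivity
  constructor
  · intro h
    by_contra htop
    have htop' : X T ω = ⊤ := by simpa using htop
    have : Rt T X ω ≤ T := ciSup_le fun i =>
      csInf_le (hbdd _) (Or.inl ⟨hTmem, by simp [htop']⟩)
    linarith
  · intro h
    obtain ⟨s, hs, hmax⟩ := isCompact_Icc.exists_isMaxOn ⟨T, hTmem⟩ hcont
    have hsfin : X s ω ≠ ⊤ := fun h' => h.ne (habs s hs h')
    obtain ⟨n, hn⟩ := ENNReal.exists_nat_gt hsfin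
    have hle : ∀ i : ℕ, hitAbove T X (i : ℝ≥0∞) ω ≤ T + 1 := fun i =>
      csInf_le (hbdd _) (Or.inr rfl)
    have hemp : {t ∈ Icc (0 : ℝ) T | (n : ℝ≥0∞) ≤ X t ω} = ∅ := by
      ext t
      simp only [mem_ofPred_eq, mem_empty_iff_false, iff_false, not_and, not_le]
      exact fun ht => (hmax ht).trans_lt hn
    have heq : hitAbove T X (n : ℝ≥0∞) ω = T + 1 := by
      rw [hitAbove, hemp, empty_union, csInf_singleton]
    refine le_antisymm (ciSup_le hle) ?_
    rw [← heq]
    exact le_ciSup (f := fun i : ℕ => hitAbove T X (i : ℝ≥0∞) ω)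
      ⟨T + 1, by rintro _ ⟨i, rfl⟩; exact hle i⟩ n

/-- The numéraire relation at a deterministic time. -/
lemma NumeraireRel.const {Q Qh : @Measure Ω (F T)} (hnum : NumeraireRel F T X x₀ Q Qh)
    (hmono : ∀ s t : ℝ, s ≤ t → F s ≤ F t) {t : ℝ} (ht : t ∈ Icc (0 : ℝ) T) {A : Set Ω}
    (hA : MeasurableSet[F t] A) :
    Qh (A ∩ {ω | X t ω < ⊤}) = (∫⁻ ω in A, X t ω ∂Q) / x₀ := by
  simpa [valueAt, min_eq_left ht.2] using
    hnum (fun _ => t) (isStopT_const ht) A (memFtau_const hmono hA)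

/-- If `X_T` is `Q̂`-a.s. finite, then `X` is a `Q`-martingale. -/
lemma isMart_of_prob_lt_top_eq_one {Q Qh : @Measure Ω (F T)} (hsetup : Setup F T X x₀ Q)
    (hQh : IsProbabilityMeasure Qh) (hnum : NumeraireRel F T X x₀ Q Qh)
    (h1 : Qh {ω | X T ω < ⊤} = 1) : IsMart F T Q X := by
  have hfin : ∀ t ∈ Icc (0 : ℝ) T, Qh {ω | X t ω < ⊤} = 1 := by
    intro t ht
    refine le_antisymm prob_le_one (h1 ▸ measure_mono fun ω (hω : X T ω < ⊤) => ?_)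
    refine lt_top_iff_ne_top.2 fun h : X t ω = ⊤ => hω.ne ?_
    rw [hsetup.absorbing ω t ht (Or.inr h) T ⟨ht.2, le_rfl⟩, h]
  have key : ∀ t ∈ Icc (0 : ℝ) T, ∀ A, MeasurableSet[F t] A →
      ∫⁻ ω in A, X t ω ∂Q = Qh A * x₀ := by
    intro t ht A hA
    have hB : MeasurableSet[F T] {ω | X t ω < ⊤} :=
      hsetup.mono t T ht.2 _
        (hsetup.adapted t ht measurableSet_Iio)
    have h := hnum.const hsetup.mono ht hA
    rw [measure_inter_of_prob_eq_one hB (hfin t ht)] at h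
    rw [h, ENNReal.div_mul_cancel hsetup.x₀_pos.ne' hsetup.x₀_lt_top.ne]
  refine ⟨hsetup.adapted, fun t ht => ?_, fun s t hs hst htT A hA => ?_⟩
  · have h := key t ht univ (@MeasurableSet.univ _ (F t))
    rw [setLIntegral_univ] at h
    rw [h]
    exact ENNReal.mul_ne_top (measure_ne_top _ _) hsetup.x₀_lt_top.ne
  · rw [key t ⟨hs.trans hst, htT⟩ A (hsetup.mono s t hst A hA), key s ⟨hs, hst.trans htT⟩ A hA]

/-- The terminal expectation of a `Q`-martingale `X` is its initial value. -/
lemma lintegral_terminal_of_isMart {Q : @Measure Ω (F T)} (hsetup : Setup F T X x₀ Q)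
    (hX : IsMart F T Q X) : ∫⁻ ω, X T ω ∂Q = x₀ := by
  have := hsetup.prob
  have h0 : (0 : ℝ) ∈ Icc (0 : ℝ) T := ⟨le_rfl, hsetup.T_pos.le⟩
  have h := hX.2.2 0 T le_rfl h0.2 le_rfl univ (@MeasurableSet.univ _ (F 0))
  rw [setLIntegral_univ, setLIntegral_univ] at h
  have hm : MeasurableSet[F T] {ω | X 0 ω = x₀} :=
    hsetup.mono 0 T h0.2 _ (hsetup.adapted 0 h0 (measurableSet_singleton x₀))
  have hae : ∀ᵐ ω ∂Q, X 0 ω = x₀ := (mem_ae_iff_prob_eq_one hm).2 hsetup.init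
  rw [h, lintegral_congr_ae hae]
  simp

end

/-- Duality, first direction.  `Q̂(R = T+1) = Q̂(X_T < ∞) = E^Q[X_T]/x₀`;
hence `Q̂(R = T+1) = 1` iff `X` is a true `Q`-martingale.  If `X` is a `Q`-martingale then
`Q̂ ≪ Q` on `F_T` with density `X_T/x₀`; if `X` is a strict `Q`-local martingale then
`Q̂(X_T < ∞) < 1` and `Q̂` is not absolutely continuous w.r.t. `Q` on `F_T`. -/
theorem statement10 {Ω : Type*} (F : ℝ → MeasurableSpace Ω) (T : ℝ)
    (X : ℝ → Ω → ℝ≥0∞) (x₀ : ℝ≥0∞) (Q Qh : @Measure Ω (F T))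
    (hsetup : Setup F T X x₀ Q) (hQh : IsProbabilityMeasure Qh)
    (hnum : NumeraireRel F T X x₀ Q Qh) :
    (Qh {ω | Rt T X ω = T + 1} = Qh {ω | X T ω < ⊤}) ∧
    (Qh {ω | X T ω < ⊤} = (∫⁻ ω, X T ω ∂Q) / x₀) ∧
    (Qh {ω | Rt T X ω = T + 1} = 1 ↔ IsMart F T Q X) ∧
    (IsMart F T Q X →
      (Qh ≪ Q ∧ ∀ A : Set Ω, MeasurableSet[F T] A →
        Qh A = (∫⁻ ω in A, X T ω ∂Q) / x₀)) ∧
    (¬ IsMart F T Q X → (Qh {ω | X T ω < ⊤} < 1 ∧ ¬ (Qh ≪ Q))) := by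
  have hTmem : T ∈ Icc (0 : ℝ) T := ⟨hsetup.T_pos.le, le_rfl⟩
  have hR : {ω | Rt T X ω = T + 1} = {ω | X T ω < ⊤} := by
    ext ω
    exact Rt_eq_iff hsetup.T_pos.le (hsetup.contPaths ω) fun t ht h => by
      rw [hsetup.absorbing ω t ht (Or.inr h) T ⟨ht.2, le_rfl⟩, h]
  have hB : MeasurableSet[F T] {ω | X T ω < ⊤} :=
    hsetup.adapted T hTmem measurableSet_Iio
  have hexp : Qh {ω | X T ω < ⊤} = (∫⁻ ω, X T ω ∂Q) / x₀ := by
    simpa using hnum.const hsetup.mono hTmem (@MeasurableSet.univ _ (F T))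
  have hmart : Qh {ω | X T ω < ⊤} = 1 ↔ IsMart F T Q X := by
    refine ⟨isMart_of_prob_lt_top_eq_one hsetup hQh hnum, fun hX => ?_⟩
    rw [hexp, lintegral_terminal_of_isMart hsetup hX,
      ENNReal.div_self hsetup.x₀_pos.ne' hsetup.x₀_lt_top.ne]
  refine ⟨by rw [hR], hexp, by rw [hR, hmart], fun hX => ?_, fun hX => ?_⟩
  · have hdens : ∀ A : Set Ω, MeasurableSet[F T] A → Qh A = (∫⁻ ω in A, X T ω ∂Q) / x₀ := by
      intro A hA
      rw [← hnum.const hsetup.mono hTmem hA, measure_inter_of_prob_eq_one hB (hmart.2 hX)]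
    refine ⟨Measure.AbsolutelyContinuous.mk fun A hA hQA => ?_, hdens⟩
    rw [hdens A hA, setLIntegral_measure_zero _ _ hQA, ENNReal.zero_div]
  · have hne : Qh {ω | X T ω < ⊤} ≠ 1 := fun h => hX (hmart.1 h)
    refine ⟨lt_of_le_of_ne prob_le_one hne, fun hac => hne ?_⟩
    have := hsetup.prob
    exact (prob_compl_eq_zero_iff hB).1
      (hac ((prob_compl_eq_zero_iff hB).2 (hR ▸ hsetup.noExplosion)))

end Paper
end
end

section
/- The following are equivalent: (a) Q(X_T > 0) = 1; (b) the process 1/X (with 1/∞ := 0, 1/0 := ∞) is a true Q̂-martingale and Q is absolutely continuous with respect to Q̂ on F_T with density dQ/dQ̂ = x_0/X_T, i.e., Q(A) = x_0·E^{Q̂}[1_A/X_T] for all A ∈ F_T. In particular, Q(X_T > 0) = x_0·E^{Q̂}[1/X_T]. -/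
open MeasureTheory Filter Set Topology
open scoped ENNReal NNReal

noncomputable section

namespace Paper

/-- Reciprocals invert the density `Y / x₀` on the set where it is positive and finite. -/
lemma mul_setLIntegral_inv_of_density {Ω : Type*} [MeasurableSpace Ω] {μ ν : Measure Ω}
    {Y : Ω → ℝ≥0∞} {x₀ : ℝ≥0∞} (hx : x₀ ≠ 0) (hx' : x₀ ≠ ⊤) (hY : Measurable Y)
    (hfin : ∀ᵐ ω ∂μ, Y ω < ⊤)
    (h : ∀ A, MeasurableSet A → ν (A ∩ {ω | Y ω < ⊤}) = (∫⁻ ω in A, Y ω ∂μ) / x₀)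
    {A : Set Ω} (hA : MeasurableSet A) :
    x₀ * ∫⁻ ω in A, (Y ω)⁻¹ ∂ν = μ (A ∩ {ω | 0 < Y ω}) := by
  have hlt : MeasurableSet {ω | Y ω < ⊤} := measurableSet_lt hY measurable_const
  have hpos : MeasurableSet {ω | 0 < Y ω} := measurableSet_lt measurable_const hY
  have hν : x₀ • ν.restrict {ω | Y ω < ⊤} = μ.withDensity Y := by
    ext B hB
    rw [Measure.smul_apply, Measure.restrict_apply hB, withDensity_apply _ hB, h B hB,
      smul_eq_mul, ENNReal.mul_div_cancel hx hx']
  have hsupp : ∫⁻ ω in A, (Y ω)⁻¹ ∂ν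
      = ∫⁻ ω in A, (Y ω)⁻¹ ∂(ν.restrict {ω | Y ω < ⊤}) := by
    rw [Measure.restrict_comm hA,
      ← lintegral_indicator hlt]
    congr 1 with ω
    by_cases hω : Y ω < ⊤
    · simp [hω]
    · simp [not_lt_top_iff.mp hω]
  calc x₀ * ∫⁻ ω in A, (Y ω)⁻¹ ∂ν
      = ∫⁻ ω in A, (Y ω)⁻¹ ∂(μ.withDensity Y) := by
        rw [hsupp, ← hν, Measure.restrict_smul, lintegral_smul_measure, smul_eq_mul]
    _ = ∫⁻ ω in A, Y ω * (Y ω)⁻¹ ∂μ := by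
        exact setLIntegral_withDensity_eq_setLIntegral_mul _ hY hY.inv hA
    _ = ∫⁻ ω in A, {ω | 0 < Y ω}.indicator 1 ω ∂μ := by
        refine lintegral_congr_ae (ae_restrict_of_ae ?_)
        filter_upwards [hfin] with ω hω
        rcases eq_or_ne (Y ω) 0 with h0 | h0
        · simp [h0]
        · simp [ENNReal.mul_inv_cancel h0 hω.ne, pos_iff_ne_zero.mpr h0]
    _ = μ (A ∩ {ω | 0 < Y ω}) := by
        rw [lintegral_indicator_one hpos, Measure.restrict_apply hpos, inter_comm]

/-- Version of `mul_setLIntegral_inv_of_density` for a density relation that holds on a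
sub-σ-algebra. -/
lemma mul_setLIntegral_inv_of_density_of_le {Ω : Type*} {m m₀ : MeasurableSpace Ω}
    (hm : m ≤ m₀) {μ ν : @Measure Ω m₀}
    {Y : Ω → ℝ≥0∞} {x₀ : ℝ≥0∞} (hx : x₀ ≠ 0) (hx' : x₀ ≠ ⊤) (hY : Measurable[m] Y)
    (hfin : ∀ᵐ ω ∂μ, Y ω < ⊤)
    (h : ∀ A, MeasurableSet[m] A →
      ν (A ∩ {ω | Y ω < ⊤}) = (∫⁻ ω in A, Y ω ∂μ) / x₀)
    {A : Set Ω} (hA : MeasurableSet[m] A) :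
    x₀ * ∫⁻ ω in A, (Y ω)⁻¹ ∂ν = μ (A ∩ {ω | 0 < Y ω}) := by
  have hlt : MeasurableSet[m] {ω | Y ω < ⊤} := measurableSet_lt hY measurable_const
  have hpos : MeasurableSet[m] {ω | 0 < Y ω} := measurableSet_lt measurable_const hY
  have hfin' : ∀ᵐ ω ∂(μ.trim hm), Y ω < ⊤ := by
    exact (trim_measurableSet_eq hm hlt.compl).trans hfin
  have hYinv : Measurable[m] fun ω => (Y ω)⁻¹ := hY.inv
  have key := @mul_setLIntegral_inv_of_density Ω m (μ.trim hm) (ν.trim hm) Y x₀ hx hx' hY hfin'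
    (fun B hB => by
      rw [trim_measurableSet_eq hm (hB.inter hlt), restrict_trim hm _ hB, lintegral_trim hm hY]
      exact h B hB) A hA
  rwa [trim_measurableSet_eq hm (hA.inter hpos), restrict_trim hm _ hA,
    lintegral_trim hm hYinv] at key

section Setup

variable {Ω : Type*} {F : ℝ → MeasurableSpace Ω} {T : ℝ} {X : ℝ → Ω → ℝ≥0∞} {x₀ : ℝ≥0∞}
  {Q Qh : @Measure Ω (F T)}

lemma Rt_le_of_eq_top (hT : 0 < T) {t : ℝ} (ht : t ∈ Icc 0 T) {ω : Ω} (hω : X t ω = ⊤) :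
    Rt T X ω ≤ t := by
  refine ciSup_le fun i => csInf_le ⟨0, ?_⟩ (Or.inl ⟨ht, by simp [hω]⟩)
  rintro s (hs | rfl)
  · exact hs.1.1
  · positivity

lemma Setup.ae_lt_top (hsetup : Setup F T X x₀ Q) {t : ℝ} (ht : t ∈ Icc 0 T) :
    ∀ᵐ ω ∂Q, X t ω < ⊤ := by
  have := hsetup.prob
  have hmeas : MeasurableSet[F T] {ω | X t ω < ⊤} :=
    hsetup.mono t T ht.2 _ (measurableSet_lt (hsetup.adapted t ht) measurable_const)
  refine (prob_compl_eq_zero_iff hmeas).mpr (le_antisymm prob_le_one ?_)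
  rw [← hsetup.noExplosion]
  refine measure_mono fun ω hω => ?_
  change X t ω < ⊤
  by_contra hlt
  have hω' : Rt T X ω = T + 1 := hω
  have := Rt_le_of_eq_top hsetup.T_pos ht (not_lt_top_iff.mp hlt)
  linarith [ht.2]

lemma NumeraireRel.at_const (hsetup : Setup F T X x₀ Q) (hnum : NumeraireRel F T X x₀ Q Qh)
    {t : ℝ} (ht : t ∈ Icc 0 T) {A : Set Ω} (hA : MeasurableSet[F t] A) :
    Qh (A ∩ {ω | X t ω < ⊤}) = (∫⁻ ω in A, X t ω ∂Q) / x₀ := by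
  have hmem : MemFtau F (fun _ => t) A := by
    intro s
    by_cases hts : t ≤ s
    · simpa [hts] using hsetup.mono t s hts A hA
    · simp [hts]
  simpa [valueAt, min_eq_left ht.2] using
    hnum (fun _ => t) ⟨fun s => MeasurableSet.const _, fun _ => Or.inl ht⟩ A hmem

/-- On `F_t`, the reciprocal of `X_t` is `1 / x₀` times the density of the part of `Q`
carried by `{X_t > 0}`. -/
lemma NumeraireRel.mul_setLIntegral_inv (hsetup : Setup F T X x₀ Q)
    (hnum : NumeraireRel F T X x₀ Q Qh) {t : ℝ} (ht : t ∈ Icc 0 T) {A : Set Ω}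
    (hA : MeasurableSet[F t] A) :
    x₀ * ∫⁻ ω in A, (X t ω)⁻¹ ∂Qh = Q (A ∩ {ω | 0 < X t ω}) :=
  mul_setLIntegral_inv_of_density_of_le (hsetup.mono t T ht.2) hsetup.x₀_pos.ne'
    hsetup.x₀_lt_top.ne (hsetup.adapted t ht) (hsetup.ae_lt_top ht)
    (fun _ hB => hnum.at_const hsetup ht hB) hA

lemma Setup.ae_pos (hsetup : Setup F T X x₀ Q) (hpos : Q {ω | 0 < X T ω} = 1) {t : ℝ}
    (ht : t ∈ Icc 0 T) : ∀ᵐ ω ∂Q, 0 < X t ω := by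
  have := hsetup.prob
  have hTpos : ∀ᵐ ω ∂Q, 0 < X T ω := (prob_compl_eq_zero_iff (measurableSet_lt measurable_const
    (hsetup.adapted T (right_mem_Icc.mpr hsetup.T_pos.le)))).mpr hpos
  filter_upwards [hTpos] with ω hω
  refine pos_iff_ne_zero.mpr fun h0 => hω.ne' ?_
  rw [hsetup.absorbing ω t ht (Or.inl h0) T (right_mem_Icc.mpr ht.2), h0]

end Setup

/-- Duality, second direction.  `Q(X_T > 0) = 1` iff `1/X` is a true
`Q̂`-martingale and `Q ≪ Q̂` on `F_T` with density `x₀/X_T`; in particular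
`Q(X_T > 0) = x₀·E^{Q̂}[1/X_T]`. -/
theorem statement11 {Ω : Type*} (F : ℝ → MeasurableSpace Ω) (T : ℝ)
    (X : ℝ → Ω → ℝ≥0∞) (x₀ : ℝ≥0∞) (Q Qh : @Measure Ω (F T))
    (hsetup : Setup F T X x₀ Q) (hQh : IsProbabilityMeasure Qh)
    (hnum : NumeraireRel F T X x₀ Q Qh) :
    (Q {ω | 0 < X T ω} = 1 ↔
      (IsMart F T Qh (fun t ω => (X t ω)⁻¹) ∧ Q ≪ Qh ∧
        ∀ A : Set Ω, MeasurableSet[F T] A →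
          Q A = x₀ * ∫⁻ ω in A, (X T ω)⁻¹ ∂Qh)) ∧
    Q {ω | 0 < X T ω} = x₀ * ∫⁻ ω, (X T ω)⁻¹ ∂Qh := by
  have hprob := hsetup.prob
  have hTmem : T ∈ Icc 0 T := right_mem_Icc.mpr hsetup.T_pos.le
  have htotal : Q {ω | 0 < X T ω} = x₀ * ∫⁻ ω, (X T ω)⁻¹ ∂Qh := by
    simpa using (hnum.mul_setLIntegral_inv hsetup hTmem MeasurableSet.univ).symm
  refine ⟨⟨fun hpos => ?_, fun ⟨_, _, hdens⟩ => ?_⟩, htotal⟩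
  · have hdens : ∀ t ∈ Icc 0 T, ∀ A, MeasurableSet[F t] A →
        x₀ * ∫⁻ ω in A, (X t ω)⁻¹ ∂Qh = Q A := fun t ht A hA => by
      rw [hnum.mul_setLIntegral_inv hsetup ht hA, inter_comm]
      exact Measure.measure_inter_eq_of_ae (t := {ω | 0 < X t ω}) (hsetup.ae_pos hpos ht)
    refine ⟨⟨fun t ht => (hsetup.adapted t ht).inv, fun t ht htop => ?_,
      fun s t hs hst htT A hA => ?_⟩, ?_, fun A hA => (hdens T hTmem A hA).symm⟩
    · have := hdens t ht univ MeasurableSet.univ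
      simp [htop, ENNReal.mul_top hsetup.x₀_pos.ne'] at this
    · refine (ENNReal.mul_right_inj hsetup.x₀_pos.ne' hsetup.x₀_lt_top.ne).mp ?_
      rw [hdens t ⟨hs.trans hst, htT⟩ A (hsetup.mono s t hst A hA),
        hdens s ⟨hs, hst.trans htT⟩ A hA]
    · refine Measure.AbsolutelyContinuous.mk fun A hA hA0 => ?_
      rw [← hdens T hTmem A hA, setLIntegral_measure_zero _ _ hA0, mul_zero]
  · rw [htotal, ← setLIntegral_univ, ← hdens univ MeasurableSet.univ, measure_univ]

end Paper
end
end
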